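/- Let λ>0 and b∈(0,1). Then n²·( √(Δ_{n+1}(λ,b)) − √(Δ_n(λ,b)) ) → b as n→∞ (square roots taken in the real sense, which is legitimate since Δ_n(λ,b) > 0 for all large n). -/

import Mathlib

open Real MeasureTheory Filter

/-- Modified Bessel function of the first kind `I_n`. -/
noncomputable def besselI (n : ℕ) (x : ℝ) : ℝ :=
  ∑' m : ℕ, (x / 2) ^ (n + 2 * m) / ((Nat.factorial m : ℝ) * (Nat.factorial (n + m) : ℝ))

/-- Modified Bessel function of the second kind `K_n`. -/
noncomputable def besselK (n : ℕ) (x : ℝ) : ℝ :=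
  ∫ t in Set.Ioi (0 : ℝ), Real.exp (-x * Real.cosh t) * Real.cosh ((n : ℝ) * t)

/-- `Λ_n(λ,b) = I_n(λb) K_n(λ)`. -/
noncomputable def Lam (n : ℕ) (l b : ℝ) : ℝ := besselI n (l * b) * besselK n l

/-- `Ω_n(x) = I_1(x)K_1(x) − I_n(x)K_n(x)`. -/
noncomputable def Om (n : ℕ) (x : ℝ) : ℝ :=
  besselI 1 x * besselK 1 x - besselI n x * besselK n x

/-- Discriminant `Δ_n(λ,b)`. -/
noncomputable def Del (n : ℕ) (l b : ℝ) : ℝ :=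
  (b * (Om n l + Om n (l * b)) - (1 + b ^ 2) * Lam 1 l b) ^ 2 - 4 * b ^ 2 * Lam n l b ^ 2

/-- `B_n(λ,b)`. -/
noncomputable def Bfun (n : ℕ) (l b : ℝ) : ℝ :=
  (1 - b ^ 2) * Lam 1 l b + b * (Om n l - Om n (l * b))

/-- `Ω_n^+(λ,b)`. -/
noncomputable def OmP (n : ℕ) (l b : ℝ) : ℝ :=
  (Bfun n l b + Real.sqrt (Del n l b)) / (2 * b)

/-- `Ω_n^−(λ,b)`. -/
noncomputable def OmM (n : ℕ) (l b : ℝ) : ℝ :=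
  (Bfun n l b - Real.sqrt (Del n l b)) / (2 * b)

/-- The matrix `M_n(λ,b,Ω)`. -/
noncomputable def Mmat (n : ℕ) (l b W : ℝ) : Matrix (Fin 2) (Fin 2) ℝ :=
  !![Om n l - W - b * Lam 1 l b, b * Lam n l b;
     -Lam n l b, Lam 1 l b - b * (Om n (l * b) + W)]


section BesselI

lemma besselI_term_le {x : ℝ} (hx : 0 ≤ x) (n m : ℕ) :
    (x / 2) ^ (n + 2 * m) / ((Nat.factorial m : ℝ) * (Nat.factorial (n + m) : ℝ)) ≤
      (x / 2) ^ n / Nat.factorial n * (((x / 2) ^ 2 / (n + 1)) ^ m / Nat.factorial m) := by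
  have h : (n.factorial : ℝ) * (n + 1) ^ m ≤ (n + m).factorial := by
    exact_mod_cast Nat.factorial_mul_pow_le_factorial
  calc (x / 2) ^ (n + 2 * m) / ((Nat.factorial m : ℝ) * (Nat.factorial (n + m) : ℝ)) ≤
      (x / 2) ^ (n + 2 * m) / ((Nat.factorial m : ℝ) * (n.factorial * (n + 1) ^ m)) := by gcongr
    _ = _ := by
      rw [pow_add, pow_mul, div_pow _ ((n : ℝ) + 1)]
      field_simp

lemma hasSum_pow_div_factorial (y : ℝ) :
    HasSum (fun m : ℕ => y ^ m / Nat.factorial m) (Real.exp y) := by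
  rw [Real.exp_eq_exp_ℝ]
  exact NormedSpace.expSeries_div_hasSum_exp y

lemma summable_besselI {x : ℝ} (hx : 0 ≤ x) (n : ℕ) : Summable fun m : ℕ =>
    (x / 2) ^ (n + 2 * m) / ((Nat.factorial m : ℝ) * (Nat.factorial (n + m) : ℝ)) :=
  Summable.of_nonneg_of_le (fun m => by positivity) (besselI_term_le hx n)
    ((hasSum_pow_div_factorial _).summable.mul_left _)

lemma besselI_pos {x : ℝ} (hx : 0 < x) (n : ℕ) : 0 < besselI n x :=
  (summable_besselI hx.le n).tsum_pos (fun m => by positivity) 0 (by positivity)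

lemma besselI_mul_le {x b : ℝ} (hx : 0 ≤ x) (hb : 0 ≤ b) (hb1 : b ≤ 1) (n : ℕ) :
    besselI n (x * b) ≤ b ^ n * besselI n x := by
  rw [besselI, besselI, ← tsum_mul_left]
  refine (summable_besselI (by positivity) n).tsum_le_tsum (fun m => ?_)
    ((summable_besselI hx n).mul_left _)
  rw [← mul_div_assoc]
  gcongr
  calc (x * b / 2) ^ (n + 2 * m) = b ^ n * b ^ (2 * m) * (x / 2) ^ (n + 2 * m) := by
        rw [← pow_add, ← mul_pow]; ring
    _ ≤ b ^ n * 1 * (x / 2) ^ (n + 2 * m) := by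
        gcongr
        exact pow_le_one₀ hb hb1
    _ = _ := by ring

/-- `I_n(x)` divided by its leading term `(x / 2)ⁿ / n!`. -/
noncomputable def besselIRatio (n : ℕ) (x : ℝ) : ℝ :=
  besselI n x * Nat.factorial n / (x / 2) ^ n

lemma besselIRatio_bounds {x : ℝ} (hx : 0 < x) (n : ℕ) :
    1 + (x / 2) ^ 2 / (n + 1) ≤ besselIRatio n x ∧
      besselIRatio n x ≤ Real.exp ((x / 2) ^ 2 / (n + 1)) := by
  constructor
  · have h := (summable_besselI hx.le n).sum_le_tsum (Finset.range 2)
      (fun m _ => by positivity)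
    rw [besselIRatio, le_div_iff₀ (by positivity)]
    refine le_trans (le_of_eq ?_) (mul_le_mul_of_nonneg_right h (by positivity))
    simp only [Finset.sum_range_succ, Finset.sum_range_zero, Nat.factorial_succ, pow_add,
      Nat.factorial_zero, Nat.add_zero]
    push_cast
    field_simp
    ring
  · have h := (summable_besselI hx.le n).tsum_le_tsum (besselI_term_le hx.le n)
      ((hasSum_pow_div_factorial _).summable.mul_left _)
    rw [tsum_mul_left, (hasSum_pow_div_factorial _).tsum_eq] at h
    rw [besselIRatio, div_le_iff₀ (by positivity)]
    refine le_trans (mul_le_mul_of_nonneg_right h (by positivity)) (le_of_eq ?_)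
    field_simp

end BesselI

section BesselK

lemma integrableOn_rpow_mul_exp_neg_mul {s r : ℝ} (hs : 0 < s) (hr : 0 < r) :
    IntegrableOn (fun u : ℝ => u ^ (s - 1) * Real.exp (-(r * u))) (Set.Ioi 0) := by
  by_contra h
  have h1 := Real.integral_rpow_mul_exp_neg_mul_Ioi hs hr
  rw [integral_undef h] at h1
  have := Real.Gamma_pos_of_pos hs
  have : 0 < (1 / r) ^ s * Real.Gamma s := by positivity
  linarith

lemma integrableOn_rpow_mul_exp_neg_mul_mul_exp_neg_div {s r : ℝ} (hs : 0 < s) (hr : 0 < r) :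
    IntegrableOn (fun u : ℝ => u ^ (s - 1) * Real.exp (-(r * u)) * Real.exp (-(r / u)))
      (Set.Ioi 0) := by
  refine Integrable.mono' (integrableOn_rpow_mul_exp_neg_mul hs hr)
    (Measurable.aestronglyMeasurable (by fun_prop)) ?_
  refine (ae_restrict_mem measurableSet_Ioi).mono fun u hu => ?_
  have hu : 0 < u := hu
  rw [Real.norm_of_nonneg (by positivity)]
  refine mul_le_of_le_one_right (by positivity) (Real.exp_le_one_iff.2 ?_)
  have : 0 < r / u := by positivity
  linarith

lemma exp_mul_rpow_exp_mul_exp_neg (x s t : ℝ) :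
    Real.exp t * (Real.exp t ^ (s - 1) * Real.exp (-(x / 2 * Real.exp t)) *
      Real.exp (-(x / 2 / Real.exp t))) = Real.exp (-x * Real.cosh t + s * t) := by
  rw [← Real.exp_mul, div_eq_mul_inv (x / 2), ← Real.exp_neg, ← Real.exp_add, ← Real.exp_add,
    ← Real.exp_add, Real.cosh_eq]
  congr 1
  ring

lemma integrable_exp_neg_mul_cosh_add {x s : ℝ} (hx : 0 < x) (hs : 0 < s) :
    Integrable (fun t : ℝ => Real.exp (-x * Real.cosh t + s * t)) := by
  have h := integrableOn_rpow_mul_exp_neg_mul_mul_exp_neg_div hs (half_pos hx)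
  rw [← Real.range_exp, ← Set.image_univ,
    integrableOn_image_iff_integrableOn_deriv_smul_of_monotoneOn MeasurableSet.univ
      (fun t _ => (Real.hasDerivAt_exp t).hasDerivWithinAt) (Real.exp_monotone.monotoneOn _),
    integrableOn_univ] at h
  simpa only [smul_eq_mul, exp_mul_rpow_exp_mul_exp_neg] using h

lemma integral_exp_neg_mul_cosh_add (x s : ℝ) :
    ∫ t : ℝ, Real.exp (-x * Real.cosh t + s * t) = ∫ u in Set.Ioi (0 : ℝ),
      u ^ (s - 1) * Real.exp (-(x / 2 * u)) * Real.exp (-(x / 2 / u)) := by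
  rw [← Real.range_exp, ← Set.image_univ,
    integral_image_eq_integral_deriv_smul_of_monotoneOn MeasurableSet.univ
      (fun t _ => (Real.hasDerivAt_exp t).hasDerivWithinAt) (Real.exp_monotone.monotoneOn _),
    setIntegral_univ]
  simp only [smul_eq_mul, exp_mul_rpow_exp_mul_exp_neg]

lemma exp_neg_mul_cosh_mul_cosh (x s t : ℝ) :
    Real.exp (-x * Real.cosh t) * Real.cosh (s * t) =
      (Real.exp (-x * Real.cosh t + s * t) + Real.exp (-x * Real.cosh (-t) + s * (-t))) / 2 := by
  rw [Real.cosh_neg, Real.exp_add, Real.exp_add, Real.cosh_eq (s * t), mul_neg]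
  ring

lemma integrable_exp_neg_mul_cosh_mul_cosh {x s : ℝ} (hx : 0 < x) (hs : 0 < s) :
    Integrable (fun t : ℝ => Real.exp (-x * Real.cosh t) * Real.cosh (s * t)) := by
  have h := integrable_exp_neg_mul_cosh_add hx hs
  simp only [exp_neg_mul_cosh_mul_cosh]
  exact (h.add h.comp_neg).div_const 2

lemma two_mul_besselK {x : ℝ} (hx : 0 < x) {n : ℕ} (hn : 0 < n) :
    2 * besselK n x = ∫ t : ℝ, Real.exp (-x * Real.cosh t + n * t) := by
  have hn' : (0 : ℝ) < n := by exact_mod_cast hn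
  have h := integrable_exp_neg_mul_cosh_add hx hn'
  have h2 := integral_comp_abs (f := fun t => Real.exp (-x * Real.cosh t) * Real.cosh (n * t))
  have h3 : ∀ t : ℝ, Real.cosh (n * |t|) = Real.cosh (n * t) := fun t => by
    rw [← Real.cosh_abs (n * t), abs_mul, Nat.abs_cast]
  simp only [Real.cosh_abs, h3] at h2
  rw [besselK, ← h2]
  simp only [exp_neg_mul_cosh_mul_cosh]
  rw [integral_div, integral_add h h.comp_neg,
    integral_neg_eq_self (fun t : ℝ => Real.exp (-x * Real.cosh t + n * t))]
  ring

lemma besselK_pos {x : ℝ} (hx : 0 < x) {n : ℕ} (hn : 0 < n) : 0 < besselK n x := by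
  have h := integral_exp_pos (integrable_exp_neg_mul_cosh_add hx (s := n) (by exact_mod_cast hn))
  rw [← two_mul_besselK hx hn] at h
  linarith

lemma besselK_antitone {x y : ℝ} (hy : 0 < y) (hyx : y ≤ x) {n : ℕ} (hn : 0 < n) :
    besselK n x ≤ besselK n y := by
  have hn' : (0 : ℝ) < n := by exact_mod_cast hn
  refine setIntegral_mono_on
    (integrable_exp_neg_mul_cosh_mul_cosh (hy.trans_le hyx) hn').integrableOn
    (integrable_exp_neg_mul_cosh_mul_cosh hy hn').integrableOn measurableSet_Ioi fun t _ => ?_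
  have := Real.cosh_pos t
  have := Real.cosh_pos (n * t)
  gcongr

lemma exp_neg_le_quadratic {v : ℝ} (hv : 0 ≤ v) : Real.exp (-v) ≤ 1 - v + v ^ 2 / 2 := by
  have h := Real.quadratic_le_exp_of_nonneg hv
  rw [Real.exp_neg, inv_le_iff_one_le_mul₀ (Real.exp_pos v)]
  nlinarith [mul_le_mul_of_nonneg_left h (by nlinarith [sq_nonneg (v - 1)] : 0 ≤ 1 - v + v ^ 2 / 2),
    sq_nonneg (v ^ 2)]

/-- `K_n(x)` divided by its leading term `(n - 1)! (x / 2)⁻ⁿ / 2`. -/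
noncomputable def besselKRatio (n : ℕ) (x : ℝ) : ℝ :=
  2 * besselK n x * (x / 2) ^ n / Real.Gamma n

lemma besselKRatio_bounds {x : ℝ} (hx : 0 < x) {n : ℕ} (hn : 3 ≤ n) :
    1 - (x / 2) ^ 2 / (n - 1) ≤ besselKRatio n x ∧
    besselKRatio n x ≤ 1 - (x / 2) ^ 2 / (n - 1) + (x / 2) ^ 4 / (2 * ((n - 1) * (n - 2))) := by
  have hn' : (3 : ℝ) ≤ n := by exact_mod_cast hn
  set r := x / 2 with hr
  have hr0 : 0 < r := half_pos hx
  set F : ℝ → ℝ → ℝ := fun s u => u ^ (s - 1) * Real.exp (-(r * u)) with hF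
  have hFi : ∀ s, 0 < s → IntegrableOn (F s) (Set.Ioi 0) := fun s hs =>
    integrableOn_rpow_mul_exp_neg_mul hs hr0
  have hFv : ∀ s, 0 < s → ∫ u in Set.Ioi 0, F s u = (1 / r) ^ s * Real.Gamma s := fun s hs =>
    Real.integral_rpow_mul_exp_neg_mul_Ioi hs hr0
  have hG1 : Real.Gamma n = (n - 1) * Real.Gamma (n - 1) := by
    have := Real.Gamma_add_one (s := (n : ℝ) - 1) (by linarith)
    rwa [sub_add_cancel] at this
  have hG2 : Real.Gamma (n - 1) = (n - 2) * Real.Gamma (n - 2) := by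
    have := Real.Gamma_add_one (s := (n : ℝ) - 2) (by linarith)
    rwa [show (n : ℝ) - 2 + 1 = n - 1 by ring] at this
  have hGp : 0 < Real.Gamma (n - 2 : ℝ) := Real.Gamma_pos_of_pos (by linarith)
  have hP1 : (1 / r) ^ ((n : ℝ) - 1) = r / r ^ n := by
    rw [Real.rpow_sub (by positivity), Real.rpow_one, Real.rpow_natCast, one_div_pow]
    field_simp
  have hP2 : (1 / r) ^ ((n : ℝ) - 2) = r ^ 2 / r ^ n := by
    rw [Real.rpow_sub (by positivity), Real.rpow_natCast]
    norm_num
    field_simp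
  have hP0 : (1 / r) ^ (n : ℝ) = 1 / r ^ n := by
    rw [Real.rpow_natCast, one_div_pow]
  have hF1 : ∀ u ∈ Set.Ioi (0 : ℝ), F (n - 1) u = F n u / u := fun u hu => by
    have hu : 0 < u := hu
    simp only [hF]
    rw [show (n : ℝ) - 1 - 1 = (n - 1 : ℝ) - 1 by ring, Real.rpow_sub_one hu.ne' ((n : ℝ) - 1)]
    ring
  have hF2 : ∀ u ∈ Set.Ioi (0 : ℝ), F (n - 2) u = F n u / u ^ 2 := fun u hu => by
    have hu : 0 < u := hu
    simp only [hF]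
    rw [show (n : ℝ) - 2 - 1 = (n - 1 : ℝ) - 1 - 1 by ring, Real.rpow_sub_one hu.ne',
      Real.rpow_sub_one hu.ne']
    field_simp
  have hK : 2 * besselK n x = ∫ u in Set.Ioi 0, F n u * Real.exp (-(r / u)) := by
    rw [two_mul_besselK hx (by omega), integral_exp_neg_mul_cosh_add]
  have hKi : IntegrableOn (fun u => F n u * Real.exp (-(r / u))) (Set.Ioi 0) :=
    integrableOn_rpow_mul_exp_neg_mul_mul_exp_neg_div (by linarith) hr0
  have hI0 := hFi n (by linarith)
  have hI1 := (hFi (n - 1) (by linarith)).const_mul r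
  have hI2 := (hFi (n - 2) (by linarith)).const_mul (r ^ 2 / 2)
  have hlow : ∫ u in Set.Ioi 0, (F n u - r * F (n - 1) u) ≤ 2 * besselK n x := by
    rw [hK]
    refine setIntegral_mono_on (hI0.sub hI1) hKi measurableSet_Ioi fun u hu => ?_
    rw [hF1 u hu]
    have hu : 0 < u := hu
    have h0 : 0 ≤ F n u := by simp only [hF]; positivity
    have := mul_le_mul_of_nonneg_left (Real.one_sub_le_exp_neg (r / u)) h0
    calc _ = F n u * (1 - r / u) := by ring
      _ ≤ _ := this
  have hupp : 2 * besselK n x ≤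
      ∫ u in Set.Ioi 0, (F n u - r * F (n - 1) u + r ^ 2 / 2 * F (n - 2) u) := by
    rw [hK]
    refine setIntegral_mono_on hKi ((hI0.sub hI1).add hI2) measurableSet_Ioi fun u hu => ?_
    rw [hF1 u hu, hF2 u hu]
    have hu : 0 < u := hu
    have h0 : 0 ≤ F n u := by simp only [hF]; positivity
    have := mul_le_mul_of_nonneg_left (exp_neg_le_quadratic (v := r / u) (by positivity)) h0
    calc _ ≤ _ := this
      _ = _ := by field_simp
  rw [integral_sub hI0 hI1, integral_const_mul, hFv _ (by linarith), hFv _ (by linarith),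
    hP0, hP1] at hlow
  rw [integral_add (f := fun u => F n u - r * F (n - 1) u) (hI0.sub hI1) hI2, integral_sub hI0 hI1, integral_const_mul,
    integral_const_mul, hFv _ (by linarith), hFv _ (by linarith), hFv _ (by linarith),
    hP0, hP1, hP2] at hupp
  have h1 : (0 : ℝ) < n - 1 := by linarith
  have h2 : (0 : ℝ) < n - 2 := by linarith
  rw [hG1, hG2] at hlow hupp
  rw [besselKRatio, ← hr, hG1, hG2]
  constructor
  · rw [le_div_iff₀ (by positivity)]
    refine le_trans (le_of_eq ?_) (mul_le_mul_of_nonneg_right hlow (by positivity : 0 ≤ r ^ n))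
    field_simp
  · rw [div_le_iff₀ (by positivity)]
    refine le_trans (mul_le_mul_of_nonneg_right hupp (by positivity : 0 ≤ r ^ n)) (le_of_eq ?_)
    field_simp

end BesselK

section Asymptotics

open Topology

lemma tendsto_natCast_mul_besselIRatio_sub_one {x : ℝ} (hx : 0 < x) :
    Tendsto (fun n : ℕ => (n : ℝ) * (besselIRatio n x - 1)) atTop (𝓝 ((x / 2) ^ 2)) := by
  set q := (x / 2) ^ 2 with hq
  have hq0 : 0 ≤ q := by positivity
  have h1 := (tendsto_natCast_div_add_atTop (1 : ℝ)).const_mul q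
  have h2 := (tendsto_natCast_div_add_atTop (1 - q : ℝ)).const_mul q
  rw [mul_one] at h1 h2
  refine tendsto_of_tendsto_of_tendsto_of_le_of_le' h1 h2 (Eventually.of_forall fun n => ?_) ?_
  · have h := mul_le_mul_of_nonneg_left (besselIRatio_bounds hx n).1 (Nat.cast_nonneg (α := ℝ) n)
    calc q * ((n : ℝ) / (n + 1)) = n * (1 + q / (n + 1)) - n := by ring
      _ ≤ _ := by linarith
  · filter_upwards [tendsto_natCast_atTop_atTop.eventually_gt_atTop q] with n hn
    have h := (besselIRatio_bounds hx n).2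
    rw [← hq] at h
    have hz : q / ((n : ℝ) + 1) < 1 := by rw [div_lt_one (by linarith)]; linarith
    have he : Real.exp (q / ((n : ℝ) + 1)) ≤ 1 / (1 - q / (n + 1)) := by
      rw [le_div_iff₀ (by linarith)]
      calc _ ≤ Real.exp (q / ((n : ℝ) + 1)) * Real.exp (-(q / (n + 1))) := by
            gcongr; exact Real.one_sub_le_exp_neg _
        _ = 1 := by rw [← Real.exp_add, add_neg_cancel, Real.exp_zero]
    have h3 : (0 : ℝ) < n + (1 - q) := by linarith
    have h4 : (0 : ℝ) < n + 1 := by linarith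
    have h5 : 1 / (1 - q / ((n : ℝ) + 1)) = 1 + q / (n + (1 - q)) := by
      rw [one_sub_div h4.ne', one_div_div, show (n : ℝ) + 1 - q = n + (1 - q) by ring]
      field_simp
      ring
    have h6 : besselIRatio n x - 1 ≤ q / (n + (1 - q)) := by linarith
    calc _ ≤ (n : ℝ) * (q / (n + (1 - q))) := by gcongr
      _ = _ := by ring

lemma tendsto_natCast_mul_besselKRatio_sub_one {x : ℝ} (hx : 0 < x) :
    Tendsto (fun n : ℕ => (n : ℝ) * (besselKRatio n x - 1)) atTop (𝓝 (-(x / 2) ^ 2)) := by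
  have h1 := (tendsto_natCast_div_add_atTop (-1 : ℝ)).const_mul (-(x / 2) ^ 2)
  have h0 : Tendsto (fun n : ℕ => ((n : ℝ) + -2)⁻¹) atTop (𝓝 0) :=
    tendsto_inv_atTop_zero.comp (tendsto_atTop_add_const_right _ _ tendsto_natCast_atTop_atTop)
  have h2 := h1.add (((tendsto_natCast_div_add_atTop (-1 : ℝ)).mul h0).const_mul ((x / 2) ^ 4 / 2))
  rw [mul_zero, mul_zero, add_zero, mul_one] at h2
  rw [mul_one] at h1
  refine tendsto_of_tendsto_of_tendsto_of_le_of_le' h1 h2 ?_ ?_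
  · filter_upwards [eventually_ge_atTop 3] with n hn
    have h := mul_le_mul_of_nonneg_left (besselKRatio_bounds hx hn).1 (Nat.cast_nonneg (α := ℝ) n)
    calc _ = n * (1 - (x / 2) ^ 2 / ((n : ℝ) - 1)) - n := by ring
      _ ≤ _ := by linarith
  · filter_upwards [eventually_ge_atTop 3] with n hn
    have h := mul_le_mul_of_nonneg_left (besselKRatio_bounds hx hn).2 (Nat.cast_nonneg (α := ℝ) n)
    have hn' : (3 : ℝ) ≤ n := by exact_mod_cast hn
    have h3 : (n : ℝ) - 1 ≠ 0 := by linarith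
    have h4 : (n : ℝ) - 2 ≠ 0 := by linarith
    calc _ = (n : ℝ) * besselKRatio n x - n := by ring
      _ ≤ n * (1 - (x / 2) ^ 2 / ((n : ℝ) - 1) + (x / 2) ^ 4 / (2 * ((n - 1) * (n - 2)))) - n := by
        linarith
      _ = _ := by
        rw [← sub_eq_add_neg, ← sub_eq_add_neg]
        field_simp
        ring

lemma tendsto_one_of_tendsto_natCast_mul_sub_one {f : ℕ → ℝ} {c : ℝ}
    (h : Tendsto (fun n : ℕ => (n : ℝ) * (f n - 1)) atTop (𝓝 c)) : Tendsto f atTop (𝓝 1) := by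
  have h1 := (h.mul (tendsto_inv_atTop_nhds_zero_nat (𝕜 := ℝ))).add_const 1
  rw [mul_zero, zero_add] at h1
  refine h1.congr' ?_
  filter_upwards [eventually_gt_atTop 0] with n hn
  have : (n : ℝ) ≠ 0 := by positivity
  field_simp
  ring

lemma natCast_mul_besselI_mul_besselK {x : ℝ} (hx : 0 < x) {n : ℕ} (hn : 0 < n) :
    2 * n * (besselI n x * besselK n x) = besselIRatio n x * besselKRatio n x := by
  have hn' : (0 : ℝ) < n := by exact_mod_cast hn
  have hG := Real.Gamma_pos_of_pos hn'
  rw [besselIRatio, besselKRatio, ← Real.Gamma_nat_eq_factorial, Real.Gamma_add_one hn'.ne']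
  field_simp

lemma tendsto_natCast_mul_two_mul_besselI_mul_besselK_sub_one {x : ℝ} (hx : 0 < x) :
    Tendsto (fun n : ℕ => (n : ℝ) * (2 * n * (besselI n x * besselK n x) - 1)) atTop (𝓝 0) := by
  have hI := tendsto_natCast_mul_besselIRatio_sub_one hx
  have hK := tendsto_natCast_mul_besselKRatio_sub_one hx
  have h := (hI.mul (tendsto_one_of_tendsto_natCast_mul_sub_one hK)).add hK
  rw [mul_one, add_neg_cancel] at h
  refine h.congr' ?_
  filter_upwards [eventually_gt_atTop 0] with n hn
  rw [natCast_mul_besselI_mul_besselK hx hn]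
  ring

lemma tendsto_natCast_mul_besselI_mul_besselK {x : ℝ} (hx : 0 < x) :
    Tendsto (fun n : ℕ => (n : ℝ) * (besselI n x * besselK n x)) atTop (𝓝 (1 / 2)) := by
  have h := (tendsto_one_of_tendsto_natCast_mul_sub_one
    (tendsto_natCast_mul_two_mul_besselI_mul_besselK_sub_one hx)).div_const 2
  exact h.congr fun n => by ring

lemma tendsto_besselI_mul_besselK {x : ℝ} (hx : 0 < x) :
    Tendsto (fun n : ℕ => besselI n x * besselK n x) atTop (𝓝 0) := by
  have h := (tendsto_natCast_mul_besselI_mul_besselK hx).mul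
    (tendsto_inv_atTop_nhds_zero_nat (𝕜 := ℝ))
  rw [mul_zero] at h
  refine h.congr' ?_
  filter_upwards [eventually_gt_atTop 0] with n hn
  have : (n : ℝ) ≠ 0 := by positivity
  field_simp

lemma tendsto_sq_mul_besselI_mul_besselK_sub {x : ℝ} (hx : 0 < x) :
    Tendsto (fun n : ℕ => (n : ℝ) ^ 2 *
      (besselI n x * besselK n x - besselI (n + 1) x * besselK (n + 1) x)) atTop (𝓝 (1 / 2)) := by
  have h := tendsto_natCast_mul_two_mul_besselI_mul_besselK_sub_one hx
  have h1 := (tendsto_add_atTop_iff_nat 1).2 h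
  have hr := tendsto_natCast_div_add_atTop (1 : ℝ)
  have h2 := ((hr.add h).sub ((hr.pow 2).mul h1)).div_const 2
  simp only [mul_zero, add_zero, sub_zero] at h2
  refine h2.congr fun n => ?_
  have : (n : ℝ) + 1 ≠ 0 := by positivity
  push_cast
  field_simp
  ring

lemma tendsto_natCast_mul_Lam {l b : ℝ} (hl : 0 < l) (hb : b ∈ Set.Ioo (0 : ℝ) 1) :
    Tendsto (fun n : ℕ => (n : ℝ) * Lam n l b) atTop (𝓝 0) := by
  have h := (tendsto_pow_atTop_nhds_zero_of_lt_one hb.1.le hb.2).mul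
    (tendsto_natCast_mul_besselI_mul_besselK hl)
  rw [zero_mul] at h
  refine squeeze_zero' ?_ ?_ h
  · filter_upwards [eventually_gt_atTop 0] with n hn
    have h1 := besselI_pos (mul_pos hl hb.1) n
    have h2 := besselK_pos hl hn
    rw [Lam]
    positivity
  · filter_upwards [eventually_gt_atTop 0] with n hn
    have h2 := besselK_pos hl hn
    rw [Lam]
    calc _ ≤ n * (b ^ n * besselI n l * besselK n l) := by
          gcongr
          exact besselI_mul_le hl.le hb.1.le hb.2.le n
      _ = _ := by ring

lemma tendsto_natCast_mul_Lam_succ {l b : ℝ} (hl : 0 < l) (hb : b ∈ Set.Ioo (0 : ℝ) 1) :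
    Tendsto (fun n : ℕ => (n : ℝ) * Lam (n + 1) l b) atTop (𝓝 0) := by
  have h := (tendsto_natCast_div_add_atTop (1 : ℝ)).mul
    ((tendsto_add_atTop_iff_nat 1).2 (tendsto_natCast_mul_Lam hl hb))
  rw [mul_zero] at h
  refine h.congr fun n => ?_
  have : (n : ℝ) + 1 ≠ 0 := by positivity
  push_cast
  field_simp

/-- The limit of `√Δ_n(λ,b)` as `n → ∞` is positive. -/
lemma mul_besselI_one_mul_besselK_one_add_sub_pos {l b : ℝ} (hl : 0 < l)
    (hb : b ∈ Set.Ioo (0 : ℝ) 1) :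
    0 < b * (besselI 1 l * besselK 1 l + besselI 1 (l * b) * besselK 1 (l * b)) -
      (1 + b ^ 2) * Lam 1 l b := by
  have hlb := mul_pos hl hb.1
  have hI : 0 ≤ b * besselI 1 l - besselI 1 (l * b) := by
    have := besselI_mul_le hl.le hb.1.le hb.2.le 1
    rw [pow_one] at this
    linarith
  have hIp := besselI_pos hlb 1
  have hKp := besselK_pos hl one_pos
  have hK : 0 < besselK 1 (l * b) - b * besselK 1 l := by
    have h1 := besselK_antitone hlb (mul_le_of_le_one_right hl.le hb.2.le) one_pos
    have h2 := mul_lt_mul_of_pos_right hb.2 hKp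
    linarith
  have hb0 := hb.1
  calc 0 < (b * besselI 1 l - besselI 1 (l * b)) * besselK 1 l +
        b * besselI 1 (l * b) * (besselK 1 (l * b) - b * besselK 1 l) := by positivity
    _ = _ := by rw [Lam]; ring

end Asymptotics

/-- `n²(√Δ_{n+1}(λ,b) − √Δ_n(λ,b)) → b` as `n → ∞`. -/
theorem sqrt_del_difference_asymptotic (l b : ℝ) (hl : 0 < l) (hb : b ∈ Set.Ioo (0:ℝ) 1) :
    Tendsto (fun n : ℕ =>
        (n : ℝ) ^ 2 * (Real.sqrt (Del (n + 1) l b) - Real.sqrt (Del n l b)))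
      atTop (nhds b) := by
  set A := b * (besselI 1 l * besselK 1 l + besselI 1 (l * b) * besselK 1 (l * b)) -
    (1 + b ^ 2) * Lam 1 l b with hA
  have hA0 : 0 < A := mul_besselI_one_mul_besselK_one_add_sub_pos hl hb
  have hlb := mul_pos hl hb.1
  set s : ℕ → ℝ := fun n => besselI n l * besselK n l + besselI n (l * b) * besselK n (l * b)
    with hs
  have hDel : ∀ n, Del n l b = (A - b * s n) ^ 2 - 4 * b ^ 2 * Lam n l b ^ 2 := fun n => by
    rw [Del, Om, Om, hA, hs]
    ring
  have hs0 : Tendsto s atTop (nhds 0) := by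
    simpa using (tendsto_besselI_mul_besselK hl).add (tendsto_besselI_mul_besselK hlb)
  have hsd : Tendsto (fun n : ℕ => (n : ℝ) ^ 2 * (s n - s (n + 1))) atTop (nhds 1) := by
    have h := (tendsto_sq_mul_besselI_mul_besselK_sub hl).add
      (tendsto_sq_mul_besselI_mul_besselK_sub hlb)
    rw [add_halves] at h
    exact h.congr fun n => by simp only [hs]; ring
  have hL := tendsto_natCast_mul_Lam hl hb
  have hL1 := tendsto_natCast_mul_Lam_succ hl hb
  have hL0 : Tendsto (fun n => Lam n l b) atTop (nhds 0) := by
    have h := hL.mul (tendsto_inv_atTop_nhds_zero_nat (𝕜 := ℝ))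
    rw [mul_zero] at h
    refine h.congr' ?_
    filter_upwards [eventually_gt_atTop 0] with n hn
    have : (n : ℝ) ≠ 0 := by positivity
    field_simp
  have ha : Tendsto (fun n => A - b * s n) atTop (nhds A) := by
    simpa using (hs0.const_mul b).const_sub A
  have ha1 := (tendsto_add_atTop_iff_nat 1).2 ha
  have hD : Tendsto (fun n => Del n l b) atTop (nhds (A ^ 2)) := by
    have h := (ha.pow 2).sub ((hL0.pow 2).const_mul (4 * b ^ 2))
    simp only [← hDel] at h
    simpa using h
  have hD1 := (tendsto_add_atTop_iff_nat 1).2 hD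
  have hR : Tendsto (fun n => Real.sqrt (Del n l b)) atTop (nhds A) := by
    have h := hD.sqrt
    rwa [Real.sqrt_sq hA0.le] at h
  have hR1 := (tendsto_add_atTop_iff_nat 1).2 hR
  have hdiff : Tendsto (fun n : ℕ => (n : ℝ) ^ 2 * (Del (n + 1) l b - Del n l b)) atTop
      (nhds (b * (A + A))) := by
    have h := ((hsd.mul (ha.add ha1)).const_mul b).sub
      (((hL1.pow 2).sub (hL.pow 2)).const_mul (4 * b ^ 2))
    simp only [one_mul, ne_eq, OfNat.ofNat_ne_zero, not_false_eq_true, zero_pow, sub_zero,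
      mul_zero] at h
    refine h.congr fun n => ?_
    rw [hDel, hDel]
    ring
  have h := hdiff.div (hR1.add hR) (by positivity)
  rw [mul_div_cancel_right₀ _ (by positivity)] at h
  refine h.congr' ?_
  have hA2 : 0 < A ^ 2 := by positivity
  filter_upwards [hD.eventually_const_lt hA2, hD1.eventually_const_lt hA2] with n h1 h2
  have h3 := Real.sqrt_pos.2 h1
  have h4 := Real.sqrt_pos.2 h2
  simp only [Pi.div_apply]
  rw [div_eq_iff (by positivity)]
  nth_rewrite 1 [← Real.sq_sqrt h1.le, ← Real.sq_sqrt h2.le]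
  ring
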